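/- Let X be a compact metric space, μ a Borel probability measure on X, U and V covers of X and β a partition of X. Then H_μ(U ∨ V | β) ≤ H_μ(U|β) + H_μ(V|β). -/

import Mathlib

open MeasureTheory Real Filter

namespace Paper

variable {X : Type*} [MeasurableSpace X]

/-- `𝒰` is a finite cover of `X` (a finite family of sets whose union is `X`). -/
def IsCover (𝒰 : Finset (Set X)) : Prop :=
  ⋃₀ (𝒰 : Set (Set X)) = Set.univ

/-- `𝒰` is a partition of `X`: a cover by pairwise disjoint sets. -/
def IsPartition (𝒰 : Finset (Set X)) : Prop :=
  IsCover 𝒰 ∧ ∀ A ∈ 𝒰, ∀ B ∈ 𝒰, A ≠ B → Disjoint A B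

/-- All members of `𝒰` are measurable (Borel) sets. -/
def MeasF (𝒰 : Finset (Set X)) : Prop := ∀ A ∈ 𝒰, MeasurableSet A

/-- `𝒰 ≽ 𝒱` : every element of `𝒰` is contained in some element of `𝒱`. -/
def Refines (𝒰 𝒱 : Finset (Set X)) : Prop := ∀ A ∈ 𝒰, ∃ B ∈ 𝒱, A ⊆ B

/-- The join `𝒰 ∨ 𝒱 = {U ∩ V : U ∈ 𝒰, V ∈ 𝒱}`. -/
noncomputable def join (𝒰 𝒱 : Finset (Set X)) : Finset (Set X) :=
  letI := Classical.decEq (Set X)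
  (𝒰 ×ˢ 𝒱).image fun p => p.1 ∩ p.2

/-- The preimage cover `f⁻¹𝒰 = {f⁻¹U : U ∈ 𝒰}`. -/
noncomputable def pre {Y : Type*} (f : X → Y) (𝒰 : Finset (Set Y)) : Finset (Set X) :=
  letI := Classical.decEq (Set X)
  𝒰.image fun U => f ⁻¹' U

/-- `dynJoin f 𝒰 N = 𝒰_0^{N-1} = ⋁_{n=0}^{N-1} f^{-n} 𝒰` (equal to `{univ}` for `N = 0`). -/
noncomputable def dynJoin (f : X → X) (𝒰 : Finset (Set X)) : ℕ → Finset (Set X)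
  | 0 => {Set.univ}
  | (N + 1) => join (dynJoin f 𝒰 N) (pre (f^[N]) 𝒰)

/-- `N(𝒰 ∩ B)`: the minimal cardinality of a subfamily of `𝒰` whose union contains `B`. -/
noncomputable def covNum (𝒰 : Finset (Set X)) (B : Set X) : ℕ :=
  sInf {k : ℕ | ∃ 𝒱 ⊆ 𝒰, 𝒱.card = k ∧ B ⊆ ⋃₀ (𝒱 : Set (Set X))}

/-- `N(𝒰|β) = max_{B ∈ β} N(𝒰 ∩ B)`. -/
noncomputable def covNumCond (𝒰 β : Finset (Set X)) : ℕ :=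
  β.sup fun B => covNum 𝒰 B

/-- The entropy `H_μ(α) = -∑_{A ∈ α} μ(A) log μ(A)` of a finite family of sets. -/
noncomputable def entPart (μ : Measure X) (α : Finset (Set X)) : ℝ :=
  ∑ A ∈ α, negMulLog (μ A).toReal

/-- Conditional entropy `H_μ(α|β) = ∑_{B ∈ β} μ(B) H_{μ_B}(α)`, where `μ_B` is the
conditional measure (which is `0` when `μ(B) = 0`). -/
noncomputable def entCondPart (μ : Measure X) (α β : Finset (Set X)) : ℝ :=
  ∑ B ∈ β, (μ B).toReal * entPart (ProbabilityTheory.cond μ B) α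

/-- `H_μ(𝒰) = inf { H_μ(α) : α a measurable partition finer than 𝒰 }`. -/
noncomputable def covEnt (μ : Measure X) (𝒰 : Finset (Set X)) : ℝ :=
  sInf {h : ℝ | ∃ α : Finset (Set X),
    IsPartition α ∧ MeasF α ∧ Refines α 𝒰 ∧ h = entPart μ α}

/-- `H_μ(𝒰|β) = ∑_{B ∈ β} μ(B) H_{μ_B}(𝒰)` for a cover `𝒰` and a partition `β`. -/
noncomputable def covEntCond (μ : Measure X) (𝒰 β : Finset (Set X)) : ℝ :=
  ∑ B ∈ β, (μ B).toReal * covEnt (ProbabilityTheory.cond μ B) 𝒰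

/-- `h_μ(α|β,f) = lim_N (1/N) H_μ(α_0^{N-1}|β_0^{N-1})`; by subadditivity the limit
equals the infimum. -/
noncomputable def hPart (f : X → X) (μ : Measure X) (α β : Finset (Set X)) : ℝ :=
  ⨅ N : ℕ, entCondPart μ (dynJoin f α (N + 1)) (dynJoin f β (N + 1)) / (N + 1 : ℝ)

/-- `h_μ^-(𝒰|β,f) = lim_N (1/N) H_μ(𝒰_0^{N-1}|β_0^{N-1})`; by subadditivity the limit
equals the infimum. -/
noncomputable def hMinus (f : X → X) (μ : Measure X) (𝒰 β : Finset (Set X)) : ℝ :=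
  ⨅ N : ℕ, covEntCond μ (dynJoin f 𝒰 (N + 1)) (dynJoin f β (N + 1)) / (N + 1 : ℝ)

/-- `h_μ^+(𝒰|β,f) = inf { h_μ(α|β,f) : α a measurable partition finer than 𝒰 }`. -/
noncomputable def hPlus (f : X → X) (μ : Measure X) (𝒰 β : Finset (Set X)) : ℝ :=
  sInf {h : ℝ | ∃ α : Finset (Set X),
    IsPartition α ∧ MeasF α ∧ Refines α 𝒰 ∧ h = hPart f μ α β}

/-- The (combinatorial/topological) conditional entropy
`h(𝒰|β,f) = lim_N (1/N) log N(𝒰_0^{N-1}|β_0^{N-1})`; by subadditivity the limit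
equals the infimum. -/
noncomputable def hTop (f : X → X) (𝒰 β : Finset (Set X)) : ℝ :=
  ⨅ N : ℕ, Real.log (covNumCond (dynJoin f 𝒰 (N + 1)) (dynJoin f β (N + 1))) / (N + 1 : ℝ)

/-- The finite family of sets associated to an indexed cover `{U_1, …, U_M}`. -/
noncomputable def rangeFinset {M : ℕ} (U : Fin M → Set X) : Finset (Set X) :=
  letI := Classical.decEq (Set X)
  Finset.image U Finset.univ

end Paper

namespace Paper

lemma isPartition_join {X : Type*} {α γ : Finset (Set X)} (hα : IsPartition α) (hγ : IsPartition γ) :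
    IsPartition (join α γ) := by
  classical
  constructor
  · refine Set.eq_univ_of_forall fun x => ?_
    obtain ⟨A, hA, hxA⟩ := Set.mem_sUnion.1 (hα.1 ▸ Set.mem_univ x : x ∈ ⋃₀ (α : Set (Set X)))
    obtain ⟨C, hC, hxC⟩ := Set.mem_sUnion.1 (hγ.1 ▸ Set.mem_univ x : x ∈ ⋃₀ (γ : Set (Set X)))
    refine Set.mem_sUnion.2 ⟨A ∩ C, ?_, hxA, hxC⟩
    exact Finset.mem_coe.2 (Finset.mem_image.2 ⟨(A, C), Finset.mk_mem_product hA hC, rfl⟩)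
  · intro S hS T hT hne
    obtain ⟨⟨A, C⟩, hAC, rfl⟩ := Finset.mem_image.1 hS
    obtain ⟨⟨B, D⟩, hBD, rfl⟩ := Finset.mem_image.1 hT
    rw [Finset.mem_product] at hAC hBD
    by_cases hAB : A = B
    · by_cases hCD : C = D
      · exact absurd (by simp [hAB, hCD]) hne
      · exact (hγ.2 C hAC.2 D hBD.2 hCD).mono Set.inter_subset_right Set.inter_subset_right
    · exact (hα.2 A hAC.1 B hBD.1 hAB).mono Set.inter_subset_left Set.inter_subset_left

lemma Refines.join {X : Type*} {α γ 𝒰 𝒱 : Finset (Set X)} (hα : Refines α 𝒰) (hγ : Refines γ 𝒱) :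
    Refines (join α γ) (join 𝒰 𝒱) := by
  intro S hS
  obtain ⟨⟨A, C⟩, hAC, rfl⟩ := Finset.mem_image.1 hS
  rw [Finset.mem_product] at hAC
  obtain ⟨U, hU, hAU⟩ := hα A hAC.1
  obtain ⟨V, hV, hCV⟩ := hγ C hAC.2
  exact ⟨U ∩ V, Finset.mem_image.2 ⟨(U, V), Finset.mk_mem_product hU hV, rfl⟩,
    Set.inter_subset_inter hAU hCV⟩

variable {X : Type*} [MeasurableSpace X]

/-- Intersecting with the members of a measurable partition splits the measure of a set. -/
lemma sum_measureReal_inter {μ : Measure X} [IsFiniteMeasure μ] {γ : Finset (Set X)}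
    (hγ : IsPartition γ) (hγm : MeasF γ) {A : Set X} (hA : MeasurableSet A) :
    ∑ C ∈ γ, μ.real (A ∩ C) = μ.real A := by
  rw [← measureReal_biUnion_finset]
  · rw [← Set.inter_iUnion₂]
    have h : ⋃ C ∈ γ, C = Set.univ := by
      rw [← hγ.1, Set.sUnion_eq_biUnion]
      simp
    rw [h, Set.inter_univ]
  · intro C hC D hD hne
    exact (hγ.2 C hC D hD hne).mono Set.inter_subset_right Set.inter_subset_right
  · exact fun C hC => hA.inter (hγm C hC)

lemma sum_measureReal_eq_one {μ : Measure X} [IsProbabilityMeasure μ] {γ : Finset (Set X)}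
    (hγ : IsPartition γ) (hγm : MeasF γ) : ∑ C ∈ γ, μ.real C = 1 := by
  simpa using sum_measureReal_inter (μ := μ) hγ hγm MeasurableSet.univ

lemma measF_join {α γ : Finset (Set X)} (hα : MeasF α) (hγ : MeasF γ) : MeasF (join α γ) := by
  intro S hS
  obtain ⟨⟨A, C⟩, hAC, rfl⟩ := Finset.mem_image.1 hS
  rw [Finset.mem_product] at hAC
  exact (hα A hAC.1).inter (hγ C hAC.2)

lemma entPart_nonneg (μ : Measure X) [IsProbabilityMeasure μ] (α : Finset (Set X)) :
    0 ≤ entPart μ α :=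
  Finset.sum_nonneg fun A _ => negMulLog_nonneg (measureReal_nonneg (μ := μ) (s := A))
    (measureReal_le_one (μ := μ) (s := A))

/-- The pointwise inequality behind subadditivity of entropy. -/
lemma negMulLog_le_of_le {p a c : ℝ} (hp : 0 ≤ p) (hpa : p ≤ a) (hpc : p ≤ c) :
    negMulLog p ≤ -(p * log a) - p * log c + (a * c - p) := by
  rcases hp.eq_or_lt with rfl | hp
  · simpa using mul_nonneg hpa hpc
  have ha := hp.trans_le hpa
  have hc := hp.trans_le hpc
  have h := log_le_sub_one_of_pos (div_pos (mul_pos ha hc) hp)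
  rw [log_div (mul_pos ha hc).ne' hp.ne', log_mul ha.ne' hc.ne'] at h
  have h' := mul_le_mul_of_nonneg_left h hp.le
  rw [mul_sub p (a * c / p), mul_div_cancel₀ _ hp.ne'] at h'
  rw [negMulLog]
  linarith

/-- Shannon entropy of partitions is subadditive. -/
lemma entPart_join_le (μ : Measure X) [IsProbabilityMeasure μ] {α γ : Finset (Set X)}
    (hα : IsPartition α) (hαm : MeasF α) (hγ : IsPartition γ) (hγm : MeasF γ) :
    entPart μ (join α γ) ≤ entPart μ α + entPart μ γ := by
  classical
  have hjoin : entPart μ (join α γ) ≤ ∑ A ∈ α, ∑ C ∈ γ, negMulLog (μ.real (A ∩ C)) := by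
    rw [← Finset.sum_product' α γ fun A C => negMulLog (μ.real (A ∩ C))]
    exact Finset.sum_image_le_of_nonneg fun S _ =>
      negMulLog_nonneg measureReal_nonneg measureReal_le_one
  have hα_eq : ∑ A ∈ α, ∑ C ∈ γ, -(μ.real (A ∩ C) * log (μ.real A)) = entPart μ α := by
    refine Finset.sum_congr rfl fun A hA => ?_
    rw [Finset.sum_neg_distrib, ← Finset.sum_mul, sum_measureReal_inter hγ hγm (hαm A hA),
      negMulLog, neg_mul]
    rfl
  have hγ_eq : ∑ A ∈ α, ∑ C ∈ γ, μ.real (A ∩ C) * log (μ.real C) = -entPart μ γ := by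
    rw [Finset.sum_comm, entPart, ← Finset.sum_neg_distrib]
    refine Finset.sum_congr rfl fun C hC => ?_
    simp_rw [Set.inter_comm _ C]
    rw [← Finset.sum_mul, sum_measureReal_inter hα hαm (hγm C hC), negMulLog, neg_mul, neg_neg]
    rfl
  have hmul : ∑ A ∈ α, ∑ C ∈ γ, μ.real A * μ.real C = 1 := by
    rw [← Finset.sum_mul_sum, sum_measureReal_eq_one hα hαm, sum_measureReal_eq_one hγ hγm,
      one_mul]
  have hinter : ∑ A ∈ α, ∑ C ∈ γ, μ.real (A ∩ C) = 1 := by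
    rw [Finset.sum_congr rfl fun A hA => sum_measureReal_inter hγ hγm (hαm A hA),
      sum_measureReal_eq_one hα hαm]
  calc entPart μ (join α γ)
      ≤ ∑ A ∈ α, ∑ C ∈ γ, negMulLog (μ.real (A ∩ C)) := hjoin
    _ ≤ ∑ A ∈ α, ∑ C ∈ γ, (-(μ.real (A ∩ C) * log (μ.real A))
          - μ.real (A ∩ C) * log (μ.real C)
          + (μ.real A * μ.real C - μ.real (A ∩ C))) :=
        Finset.sum_le_sum fun A _ => Finset.sum_le_sum fun C _ =>
          negMulLog_le_of_le measureReal_nonneg (measureReal_mono Set.inter_subset_left)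
            (measureReal_mono Set.inter_subset_right)
    _ = entPart μ α + entPart μ γ := by
        simp_rw [Finset.sum_add_distrib, Finset.sum_sub_distrib]
        rw [hα_eq, hγ_eq, hmul, hinter]
        ring

lemma exists_disjoint_refines (𝒰 : Finset (Set X)) (h𝒰m : MeasF 𝒰) :
    ∃ α : Finset (Set X), ⋃₀ (α : Set (Set X)) = ⋃₀ (𝒰 : Set (Set X)) ∧
      (∀ A ∈ α, ∀ B ∈ α, A ≠ B → Disjoint A B) ∧ MeasF α ∧ Refines α 𝒰 := by
  classical
  induction 𝒰 using Finset.induction_on with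
  | empty => exact ⟨∅, rfl, by simp, by simp [MeasF], by simp [Refines]⟩
  | insert U 𝒰 _ ih =>
    obtain ⟨α, hU, hd, hm, hr⟩ := ih fun A hA => h𝒰m A (Finset.mem_insert_of_mem hA)
    have hdU : ∀ B ∈ α, Disjoint (U \ ⋃₀ (𝒰 : Set (Set X))) B := fun B hB =>
      Set.disjoint_sdiff_left.mono_right (hU ▸ Set.subset_sUnion_of_mem (Finset.mem_coe.2 hB))
    refine ⟨insert (U \ ⋃₀ (𝒰 : Set (Set X))) α, ?_, ?_, ?_, ?_⟩
    · simp only [Finset.coe_insert, Set.sUnion_insert, hU, Set.sdiff_union_self]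
    · intro A hA B hB hne
      rcases Finset.mem_insert.1 hA with rfl | hA <;> rcases Finset.mem_insert.1 hB with rfl | hB
      · exact absurd rfl hne
      · exact hdU B hB
      · exact (hdU A hA).symm
      · exact hd A hA B hB hne
    · intro A hA
      rcases Finset.mem_insert.1 hA with rfl | hA
      · exact (h𝒰m U (Finset.mem_insert_self U 𝒰)).diff (MeasurableSet.sUnion
          𝒰.countable_toSet fun V hV => h𝒰m V (Finset.mem_insert_of_mem hV))
      · exact hm A hA
    · intro A hA
      rcases Finset.mem_insert.1 hA with rfl | hA
      · exact ⟨U, Finset.mem_insert_self U 𝒰, Set.sdiff_subset⟩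
      · obtain ⟨B, hB, hAB⟩ := hr A hA
        exact ⟨B, Finset.mem_insert_of_mem hB, hAB⟩

lemma exists_isPartition_refines {𝒰 : Finset (Set X)} (h𝒰 : IsCover 𝒰) (h𝒰m : MeasF 𝒰) :
    ∃ α : Finset (Set X), IsPartition α ∧ MeasF α ∧ Refines α 𝒰 := by
  obtain ⟨α, hU, hd, hm, hr⟩ := exists_disjoint_refines 𝒰 h𝒰m
  exact ⟨α, ⟨hU.trans h𝒰, hd⟩, hm, hr⟩

lemma covEnt_le (μ : Measure X) [IsProbabilityMeasure μ] {𝒰 α : Finset (Set X)}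
    (hα : IsPartition α) (hαm : MeasF α) (hr : Refines α 𝒰) : covEnt μ 𝒰 ≤ entPart μ α := by
  refine csInf_le ⟨0, ?_⟩ ⟨α, hα, hαm, hr, rfl⟩
  rintro _ ⟨γ, -, -, -, rfl⟩
  exact entPart_nonneg μ γ

lemma le_covEnt (μ : Measure X) {𝒰 : Finset (Set X)} (h𝒰 : IsCover 𝒰) (h𝒰m : MeasF 𝒰) {r : ℝ}
    (h : ∀ α, IsPartition α → MeasF α → Refines α 𝒰 → r ≤ entPart μ α) : r ≤ covEnt μ 𝒰 := by
  obtain ⟨α, hα, hαm, hr⟩ := exists_isPartition_refines h𝒰 h𝒰m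
  refine le_csInf ⟨_, α, hα, hαm, hr, rfl⟩ ?_
  rintro _ ⟨γ, hγ, hγm, hγr, rfl⟩
  exact h γ hγ hγm hγr

/-- The entropy of covers is subadditive. -/
lemma covEnt_join_le (μ : Measure X) [IsProbabilityMeasure μ] {𝒰 𝒱 : Finset (Set X)}
    (h𝒰 : IsCover 𝒰) (h𝒰m : MeasF 𝒰) (h𝒱 : IsCover 𝒱) (h𝒱m : MeasF 𝒱) :
    covEnt μ (join 𝒰 𝒱) ≤ covEnt μ 𝒰 + covEnt μ 𝒱 := by
  rw [← sub_le_iff_le_add]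
  refine le_covEnt μ h𝒰 h𝒰m fun α hα hαm hαr => ?_
  rw [sub_le_comm]
  refine le_covEnt μ h𝒱 h𝒱m fun γ hγ hγm hγr => ?_
  rw [sub_le_iff_le_add']
  exact (covEnt_le μ (isPartition_join hα hγ) (measF_join hαm hγm) (hαr.join hγr)).trans
    (entPart_join_le μ hα hαm hγ hγm)

end Paper

open Paper MeasureTheory Real Filter

/-- For a Borel probability measure `μ` on a compact metric space `X`,
covers `𝒰, 𝒱` and a partition `β`: `H_μ(𝒰 ∨ 𝒱 | β) ≤ H_μ(𝒰|β) + H_μ(𝒱|β)`. -/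
theorem statement8 {X : Type*} [MetricSpace X] [CompactSpace X]
    [MeasurableSpace X] [BorelSpace X]
    (μ : MeasureTheory.Measure X) [MeasureTheory.IsProbabilityMeasure μ]
    (𝒰 𝒱 β : Finset (Set X)) (h𝒰 : IsCover 𝒰) (h𝒰m : MeasF 𝒰)
    (h𝒱 : IsCover 𝒱) (h𝒱m : MeasF 𝒱) (hβ : IsPartition β) (hβm : MeasF β) :
    covEntCond μ (join 𝒰 𝒱) β ≤ covEntCond μ 𝒰 β + covEntCond μ 𝒱 β := by
  unfold covEntCond
  rw [← Finset.sum_add_distrib]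
  refine Finset.sum_le_sum fun B _ => ?_
  rw [← mul_add]
  by_cases hB : μ B = 0
  · simp [hB]
  · have := ProbabilityTheory.cond_isProbabilityMeasure hB
    exact mul_le_mul_of_nonneg_left (covEnt_join_le _ h𝒰 h𝒰m h𝒱 h𝒱m) ENNReal.toReal_nonneg
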